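/- Let M′ be the L₁-structure described in the context and T′ = Th(M′). Then T′_aut has no model completion: there is no L₁⁺-theory T* which is a model completion of T′_aut. -/

import Mathlib

namespace FirstOrder

open Language Structure

namespace ShelahE34

universe u v w

/-- The index type for the function symbols of the language consisting of a single
unary function symbol `σ`. -/
inductive SigmaFunc : ℕ → Type
  | sigma : SigmaFunc 1

/-- The language consisting of a single unary function symbol `σ`. -/
def sigmaLang : Language.{0, 0} :=
  ⟨SigmaFunc, fun _ => Empty⟩

/-- `L⁺`: the language `L` expanded by one new unary function symbol `σ`. -/
abbrev LPlus (L : Language.{u, v}) : Language :=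
  L.sum sigmaLang

/-- The new unary function symbol `σ` of `L⁺`. -/
def sigmaSymb (L : Language.{u, v}) : (LPlus L).Functions 1 :=
  Sum.inr SigmaFunc.sigma

/-- Application of the symbol `σ` to a term of `L⁺`. -/
def sigmaTerm {L : Language.{u, v}} {α : Type w} (t : (LPlus L).Term α) : (LPlus L).Term α :=
  Functions.apply₁ (sigmaSymb L) t

/-- The interpretation of the symbol `σ` in an `L⁺`-structure, as a function. -/
def sigmaMap (L : Language.{u, v}) (N : Type w) [(LPlus L).Structure N] : N → N :=
  fun x => funMap (sigmaSymb L) ![x]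

/-- The sentence `(∀x)(∀y)(σ(x) = σ(y) → x = y)`. -/
def sigmaInj (L : Language.{u, v}) : (LPlus L).Sentence :=
  ∀' ∀' ((sigmaTerm (&0) =' sigmaTerm (&1)) ⟹ ((&0) =' (&1)))

/-- The sentence `(∀y)(∃x)(σ(x) = y)`. -/
def sigmaSurj (L : Language.{u, v}) : (LPlus L).Sentence :=
  ∀' ∃' (sigmaTerm (&1) =' (&0))

/-- The sentence `(∀x̄)(F(σ(x̄)) = σ(F(x̄)))` for a function symbol `F` of `L`. -/
def funCommSentence (L : Language.{u, v}) {n : ℕ} (F : L.Functions n) : (LPlus L).Sentence :=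
  BoundedFormula.alls
    (sigmaTerm (Term.func (Sum.inl F : (LPlus L).Functions n) fun i => Term.var (Sum.inr i)) ='
      Term.func (Sum.inl F : (LPlus L).Functions n) fun i => sigmaTerm (Term.var (Sum.inr i)))

/-- The sentence `(∀x̄)(R(x̄) ↔ R(σ(x̄)))` for a relation symbol `R` of `L`. -/
def relPresSentence (L : Language.{u, v}) {n : ℕ} (R : L.Relations n) : (LPlus L).Sentence :=
  BoundedFormula.alls
    ((Relations.boundedFormula (Sum.inl R : (LPlus L).Relations n)
        fun i => Term.var (Sum.inr i)) ⇔
      Relations.boundedFormula (Sum.inl R : (LPlus L).Relations n)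
        fun i => sigmaTerm (Term.var (Sum.inr i)))

/-- `T_aut`: the `L⁺`-theory consisting of `T` together with the sentences asserting that `σ`
is an automorphism. -/
def Taut {L : Language.{u, v}} (T : L.Theory) : (LPlus L).Theory :=
  (LHom.sumInl : L →ᴸ LPlus L).onTheory T ∪ {sigmaInj L, sigmaSurj L} ∪
    {φ | ∃ (n : ℕ) (F : L.Functions n), φ = funCommSentence L F} ∪
    {φ | ∃ (n : ℕ) (R : L.Relations n), φ = relPresSentence L R}

/-- A theory is complete and consistent if it is satisfiable and semantically decides every
sentence. -/
def SemComplete {L' : Language.{u, v}} (U : L'.Theory) : Prop :=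
  U.IsSatisfiable ∧ ∀ φ : L'.Sentence, U ⊨ᵇ φ ∨ U ⊨ᵇ ∼φ

/-- A completion of a theory `S`: a complete consistent theory in the same language
containing `S`. -/
def IsCompletionOf {L' : Language.{u, v}} (S U : L'.Theory) : Prop :=
  S ⊆ U ∧ SemComplete U

/-- The atomic diagram of a structure `M`: all atomic and negated atomic sentences with
constants from `M` that hold in `M`. -/
def atomicDiagram (L' : Language.{u, v}) (M : Type w) [L'.Structure M] : (L'[[M]]).Theory :=
  {φ | (φ.IsAtomic ∨ ∃ ψ : (L'[[M]]).Sentence, ψ.IsAtomic ∧ φ = ∼ψ) ∧ M ⊨ φ}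

/-- `Tstar` is a model completion of `S`: it contains `S`, every model of `S` embeds into a
model of `Tstar`, and for every model `M` of `S`, `Tstar` together with the atomic diagram of
`M` is a complete consistent theory. -/
def IsModelCompletion.{u', v', w'} {L' : Language.{u', v'}} (S Tstar : L'.Theory) : Prop :=
  S ⊆ Tstar ∧
    (∀ M : Theory.ModelType.{u', v', w'} S, ∃ N : Theory.ModelType.{u', v', w'} Tstar,
      Nonempty (M ↪[L'] N)) ∧
    ∀ M : Theory.ModelType.{u', v', w'} S,
      SemComplete ((L'.lhomWithConstants M).onTheory Tstar ∪ atomicDiagram L' M)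

/-- The relation symbols of the language `L₁`: binary symbols `Eₙ` (`n ∈ ℕ`), `E` and `E⁎`,
and unary symbols `Pₘ` (`m ∈ ℕ`). -/
inductive L1Rel : ℕ → Type
  | En : ℕ → L1Rel 2
  | E : L1Rel 2
  | Estar : L1Rel 2
  | P : ℕ → L1Rel 1

/-- The language `L₁` (a relational language). -/
def L1 : Language.{0, 0} :=
  ⟨fun _ => Empty, L1Rel⟩

/-- The universe of the structure `M′`: quadruples `(η, k, n, ℓ)` with `η ∈ 2^ℕ`,
`k, n ∈ ℕ`, `ℓ ∈ {0, 1}` (as a Boolean). -/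
def M1Point : Type :=
  (ℕ → Bool) × ℕ × ℕ × Bool

instance : Nonempty M1Point :=
  ⟨⟨fun _ => false, 0, 0, false⟩⟩

/-- The `L₁`-structure `M′`. -/
instance L1StructureM1Point : L1.Structure M1Point where
  funMap f _ := f.elim
  RelMap {m} r x :=
    match r, x with
    | .En n, x => ∀ i < n, (x 0).1 i = (x 1).1 i
    | .E, x => (x 0).1 = (x 1).1 ∧ (x 0).2.1 = (x 1).2.1
    | .Estar, x => (x 0).1 = (x 1).1 ∧ (x 0).2.1 = (x 1).2.1 ∧ (x 0).2.2.1 = (x 1).2.2.1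
    | .P m, x => (x 0).2.2.1 = m

set_option linter.style.haveILetI false

/-- Parameters for the auxiliary models. -/
structure Dat : Type (u + 1) where
  I : Type u
  e : I ≃ I
  p : I → Bool
  m : ℕ
  b : Bool
  hp : ∀ k, p (e k) = xor b (p k)

/-- The universe of the auxiliary model. -/
def W (D : Dat.{u}) : Type u := (ℕ → Bool) × D.I × ℕ × Bool

/-- The branch attached to a point of the auxiliary model. -/
def W.code {D : Dat.{u}} (x : W D) : ℕ → Bool :=
  fun i => xor (x.1 i) (D.p x.2.1 && decide (i = D.m))

instance W.L1Structure (D : Dat.{u}) : L1.Structure (W D) where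
  funMap f _ := f.elim
  RelMap {m} r x :=
    match r, x with
    | .En n, x => ∀ i < n, (x 0).code i = (x 1).code i
    | .E, x => (x 0).1 = (x 1).1 ∧ (x 0).2.1 = (x 1).2.1
    | .Estar, x => (x 0).1 = (x 1).1 ∧ (x 0).2.1 = (x 1).2.1 ∧ (x 0).2.2.1 = (x 1).2.2.1
    | .P m, x => (x 0).2.2.1 = m

/-- The automorphism of the auxiliary model. -/
def W.sig {D : Dat.{u}} (x : W D) : W D := (x.1, D.e x.2.1, x.2.2.1, x.2.2.2)

instance W.sigmaStructure (D : Dat.{u}) : sigmaLang.Structure (W D) where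
  funMap f x :=
    match f, x with
    | .sigma, x => (x 0).sig
  RelMap r _ := r.elim

theorem W.code_sig {D : Dat.{u}} (x : W D) (i : ℕ) :
    x.sig.code i = xor (x.code i) (D.b && decide (i = D.m)) := by
  simp only [W.code, W.sig, D.hp]
  cases x.1 i <;> cases D.p x.2.1 <;> cases D.b <;> cases decide (i = D.m) <;> rfl

theorem W.code_inj {D : Dat.{u}} {x y : W D} (h : x.2.1 = y.2.1) :
    x.code = y.code ↔ x.1 = y.1 := by
  constructor
  · intro hc
    funext i
    have := congrFun hc i
    simp only [W.code, h] at this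
    simpa using this
  · intro hc
    funext i
    simp only [W.code, h, hc]

/-- The auxiliary model is isomorphic to `M′`. -/
def W.equivM1 (D : Dat.{u}) (j : D.I ≃ ℕ) : W D ≃[L1] M1Point where
  toFun x := (x.code, j x.2.1, x.2.2.1, x.2.2.2)
  invFun y := (fun i => xor (y.1 i) (D.p (j.symm y.2.1) && decide (i = D.m)),
    j.symm y.2.1, y.2.2.1, y.2.2.2)
  left_inv x := by
    refine Prod.ext ?_ (Prod.ext ?_ rfl)
    · funext i
      simp [W.code]
    · simp
  right_inv y := by
    refine Prod.ext ?_ (Prod.ext ?_ rfl)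
    · funext i
      simp [W.code]
    · simp
  map_fun' f _ := f.elim
  map_rel' r x := by
    cases r with
    | En n => exact Iff.rfl
    | E =>
      change (x 0).code = (x 1).code ∧ j (x 0).2.1 = j (x 1).2.1 ↔
        (x 0).1 = (x 1).1 ∧ (x 0).2.1 = (x 1).2.1
      rw [j.injective.eq_iff]
      exact and_congr_left fun h => W.code_inj h
    | Estar =>
      change (x 0).code = (x 1).code ∧ j (x 0).2.1 = j (x 1).2.1 ∧ (x 0).2.2.1 = (x 1).2.2.1 ↔
        (x 0).1 = (x 1).1 ∧ (x 0).2.1 = (x 1).2.1 ∧ (x 0).2.2.1 = (x 1).2.2.1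
      rw [j.injective.eq_iff]
      exact and_congr_left fun h => W.code_inj h.1
    | P m => exact Iff.rfl

theorem sig_rel {D : Dat.{u}} {n : ℕ} (R : L1.Relations n) (x : Fin n → W D) :
    RelMap R x ↔ RelMap R (fun i => (x i).sig) := by
  cases R with
  | En n =>
    change (∀ i < n, (x 0).code i = (x 1).code i) ↔
      (∀ i < n, (x 0).sig.code i = (x 1).sig.code i)
    simp only [W.code_sig, Bool.xor_left_inj]
  | E =>
    change ((x 0).1 = (x 1).1 ∧ (x 0).2.1 = (x 1).2.1) ↔
      ((x 0).1 = (x 1).1 ∧ D.e (x 0).2.1 = D.e (x 1).2.1)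
    rw [D.e.injective.eq_iff]
  | Estar =>
    change ((x 0).1 = (x 1).1 ∧ (x 0).2.1 = (x 1).2.1 ∧ (x 0).2.2.1 = (x 1).2.2.1) ↔
      ((x 0).1 = (x 1).1 ∧ D.e (x 0).2.1 = D.e (x 1).2.1 ∧ (x 0).2.2.1 = (x 1).2.2.1)
    rw [D.e.injective.eq_iff]
  | P m => exact Iff.rfl

theorem realize_sigmaTerm {L : Language.{u, v}} {N : Type*} [(LPlus L).Structure N] {α : Type*}
    (t : (LPlus L).Term α) (v : α → N) :
    (sigmaTerm t).realize v = sigmaMap L N (t.realize v) := by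
  simp [sigmaTerm, sigmaMap, Term.realize_functions_apply₁]

/-- A relation symbol of `L₁` in `L₁⁺`. -/
def liftR {n : ℕ} (R : L1.Relations n) : (LPlus L1).Relations n := Sum.inl R

theorem realize_relPres {N : Type*} [(LPlus L1).Structure N] {n : ℕ} (R : L1.Relations n) :
    N ⊨ relPresSentence L1 R ↔ ∀ xs : Fin n → N,
      (RelMap (liftR R) xs ↔ RelMap (liftR R) (fun i => sigmaMap L1 N (xs i))) := by
  have e : relPresSentence L1 R = BoundedFormula.alls
    (((liftR R).boundedFormula fun i => Term.var (Sum.inr i)) ⇔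
      (liftR R).boundedFormula fun i => sigmaTerm (Term.var (Sum.inr i))) := rfl
  rw [e]
  refine (BoundedFormula.realize_alls).trans (forall_congr' fun xs => ?_)
  simp only [BoundedFormula.realize_iff, BoundedFormula.realize_rel, realize_sigmaTerm,
      Term.realize_var, Sum.elim_inr]

theorem W.model (D : Dat.{u}) (j : D.I ≃ ℕ) : W D ⊨ Taut (L1.completeTheory M1Point) := by
  rw [Theory.model_iff]
  rintro φ (((hφ | hφ) | hφ) | hφ)
  · obtain ⟨ψ, hψ, rfl⟩ := hφ
    have : W D ⊨ ψ := (StrongHomClass.realize_sentence (W.equivM1 D j) ψ).2 hψ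
    exact (LHom.realize_onSentence (W D) (LHom.sumInl : L1 →ᴸ LPlus L1) ψ).2 this
  · rcases hφ with rfl | rfl
    · simp only [sigmaInj, Sentence.Realize, Formula.Realize, BoundedFormula.realize_all,
        BoundedFormula.realize_imp, BoundedFormula.realize_bdEqual, realize_sigmaTerm]
      intro x y h
      change W.sig x = W.sig y at h
      change x = y
      have h1 : x.1 = y.1 := congrArg (β := ℕ → Bool) (a₁ := W.sig x) (a₂ := W.sig y)
        (fun z : W D => z.1) h
      have h2 : D.e x.2.1 = D.e y.2.1 := congrArg (fun z : W D => z.2.1) h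
      have h3 : x.2.2 = y.2.2 := congrArg (β := ℕ × Bool) (a₁ := W.sig x) (a₂ := W.sig y)
        (fun z : W D => z.2.2) h
      exact Prod.ext h1 (Prod.ext (D.e.injective h2) h3)
    · simp only [sigmaSurj, Sentence.Realize, Formula.Realize, BoundedFormula.realize_all,
        BoundedFormula.realize_ex, BoundedFormula.realize_bdEqual, realize_sigmaTerm]
      intro y
      refine ⟨((y.1, D.e.symm y.2.1, y.2.2.1, y.2.2.2) : W D), ?_⟩
      change W.sig ((y.1, D.e.symm y.2.1, y.2.2.1, y.2.2.2) : W D) = y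
      exact Prod.ext rfl (Prod.ext (D.e.apply_symm_apply _) rfl)
  · obtain ⟨n, F, rfl⟩ := hφ
    exact F.elim
  · obtain ⟨n, R, rfl⟩ := hφ
    rw [realize_relPres]
    exact fun xs => sig_rel R xs

/-- A binary relation of `L₁` in an `L₁⁺`-structure. -/
def rel2 {N : Type*} [(LPlus L1).Structure N] (R : L1.Relations 2) (x y : N) : Prop :=
  RelMap (liftR R) ![x, y]

/-- `Eₙ` as a relation symbol. -/
def symEn (n : ℕ) : L1.Relations 2 := L1Rel.En n

/-- `E` as a relation symbol. -/
def symE : L1.Relations 2 := L1Rel.E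

section Facts

variable {N : Type*} [(LPlus L1).Structure N]

theorem transfer (hN : N ⊨ Taut (L1.completeTheory M1Point)) (ψ : L1.Sentence)
    (hψ : M1Point ⊨ ψ) :
    @Sentence.Realize L1 N ((LHom.sumInl : L1 →ᴸ LPlus L1).reduct N) ψ := by
  letI := (LHom.sumInl : L1 →ᴸ LPlus L1).reduct N
  refine (LHom.realize_onSentence N (LHom.sumInl : L1 →ᴸ LPlus L1) ψ).1 ?_
  exact (Theory.model_iff _).1 hN _ (Or.inl (Or.inl (Or.inl ⟨ψ, hψ, rfl⟩)))

theorem relEn (n : ℕ) (x y : M1Point) :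
    RelMap (symEn n) ![x, y] ↔ ∀ i < n, x.1 i = y.1 i := Iff.rfl

theorem relE (x y : M1Point) :
    RelMap symE ![x, y] ↔ x.1 = y.1 ∧ x.2.1 = y.2.1 := Iff.rfl

theorem En_trans (hN : N ⊨ Taut (L1.completeTheory M1Point)) (n : ℕ) {x y z : N}
    (h1 : rel2 (symEn n) x y) (h2 : rel2 (symEn n) y z) : rel2 (symEn n) x z := by
  have key := transfer hN (symEn n).transitive (by
    rw [Relations.realize_transitive]
    exact ⟨fun a b c h h' i hi => (h i hi).trans (h' i hi)⟩)
  letI := (LHom.sumInl : L1 →ᴸ LPlus L1).reduct N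
  rw [Relations.realize_transitive] at key
  exact key.trans x y z h1 h2

theorem En_symm (hN : N ⊨ Taut (L1.completeTheory M1Point)) (n : ℕ) {x y : N}
    (h1 : rel2 (symEn n) x y) : rel2 (symEn n) y x := by
  have key := transfer hN (symEn n).symmetric (by
    rw [Relations.realize_symmetric]
    exact ⟨fun a b h i hi => (h i hi).symm⟩)
  letI := (LHom.sumInl : L1 →ᴸ LPlus L1).reduct N
  rw [Relations.realize_symmetric] at key
  exact key.symm x y h1

/-- `E` refines `Eₙ`. -/
def refineS (n : ℕ) : L1.Sentence :=
  ∀' ∀' (symE.boundedFormula₂ (&0) (&1) ⟹ (symEn n).boundedFormula₂ (&0) (&1))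

theorem realize_refineS (n : ℕ) {A : Type*} [L1.Structure A] :
    A ⊨ refineS n ↔ ∀ x y : A, RelMap symE ![x, y] → RelMap (symEn n) ![x, y] := by
  simp only [refineS, Sentence.Realize, Formula.Realize, BoundedFormula.realize_all,
    BoundedFormula.realize_imp, BoundedFormula.realize_rel₂]
  rfl

theorem E_refine (hN : N ⊨ Taut (L1.completeTheory M1Point)) (n : ℕ) {x y : N}
    (h1 : rel2 symE x y) : rel2 (symEn n) x y := by
  have key := transfer hN (refineS n) (by
    rw [realize_refineS]
    intro x y h
    rw [relE] at h
    rw [relEn, h.1]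
    exact fun _ _ => rfl)
  letI := (LHom.sumInl : L1 →ᴸ LPlus L1).reduct N
  rw [realize_refineS] at key
  exact key x y h1

/-- `E₀` is universal. -/
def totalS : L1.Sentence :=
  ∀' ∀' ((symEn 0).boundedFormula₂ (&0) (&1))

theorem realize_totalS {A : Type*} [L1.Structure A] :
    A ⊨ totalS ↔ ∀ x y : A, RelMap (symEn 0) ![x, y] := by
  simp only [totalS, Sentence.Realize, Formula.Realize, BoundedFormula.realize_all,
    BoundedFormula.realize_rel₂]
  rfl

theorem E0_total (hN : N ⊨ Taut (L1.completeTheory M1Point)) (x y : N) :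
    rel2 (symEn 0) x y := by
  have key := transfer hN totalS (by
    rw [realize_totalS]
    intro x y
    rw [relEn]
    exact fun i hi => absurd hi (Nat.not_lt_zero i))
  letI := (LHom.sumInl : L1 →ᴸ LPlus L1).reduct N
  rw [realize_totalS] at key
  exact key x y

/-- Every `Eₙ`-class splits into at most two `Eₙ₊₁`-classes. -/
def splitS (n : ℕ) : L1.Sentence :=
  ∀' ∀' ∀' ((symEn n).boundedFormula₂ (&0) (&1) ⟹ ((symEn n).boundedFormula₂ (&0) (&2) ⟹
    (∼((symEn (n+1)).boundedFormula₂ (&1) (&2)) ⟹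
      (∼((symEn (n+1)).boundedFormula₂ (&0) (&1)) ⟹
        (symEn (n+1)).boundedFormula₂ (&0) (&2)))))

theorem realize_splitS (n : ℕ) {A : Type*} [L1.Structure A] :
    A ⊨ splitS n ↔ ∀ x y z : A, RelMap (symEn n) ![x, y] → RelMap (symEn n) ![x, z] →
      ¬ RelMap (symEn (n+1)) ![y, z] → ¬ RelMap (symEn (n+1)) ![x, y] →
      RelMap (symEn (n+1)) ![x, z] := by
  simp only [splitS, Sentence.Realize, Formula.Realize, BoundedFormula.realize_all,
    BoundedFormula.realize_imp, BoundedFormula.realize_not, BoundedFormula.realize_rel₂]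
  rfl

theorem En_split (hN : N ⊨ Taut (L1.completeTheory M1Point)) (n : ℕ) {x y z : N}
    (h1 : rel2 (symEn n) x y) (h2 : rel2 (symEn n) x z) (h3 : ¬ rel2 (symEn (n+1)) y z)
    (h4 : ¬ rel2 (symEn (n+1)) x y) : rel2 (symEn (n+1)) x z := by
  have key := transfer hN (splitS n) (by
    rw [realize_splitS]
    intro x y z
    simp only [relEn]
    have key : ∀ a b : M1Point, (∀ i < n, a.1 i = b.1 i) →
        ((∀ i < n+1, a.1 i = b.1 i) ↔ a.1 n = b.1 n) := by
      intro a b h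
      refine ⟨fun h => h n (Nat.lt_succ_self n), fun h' i hi => ?_⟩
      rcases Nat.lt_succ_iff_lt_or_eq.1 hi with hi | rfl
      · exact h i hi
      · exact h'
    intro hxy hxz
    rw [key x y hxy, key x z hxz, key y z fun i hi => (hxy i hi).symm.trans (hxz i hi)]
    cases x.1 n <;> cases y.1 n <;> cases z.1 n <;> simp)
  letI := (LHom.sumInl : L1 →ᴸ LPlus L1).reduct N
  rw [realize_splitS] at key
  exact key x y z h1 h2 h3 h4

theorem sig_pres (hN : N ⊨ Taut (L1.completeTheory M1Point)) (R : L1.Relations 2) {x y : N}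
    (h : rel2 R x y) : rel2 R (sigmaMap L1 N x) (sigmaMap L1 N y) := by
  have := (Theory.model_iff _).1 hN (relPresSentence L1 R) (Or.inr ⟨2, R, rfl⟩)
  rw [realize_relPres] at this
  have h2 := (this ![x, y]).1 h
  have e : (fun i => sigmaMap L1 N (![x, y] i)) = ![sigmaMap L1 N x, sigmaMap L1 N y] := by
    funext i; fin_cases i <;> rfl
  rw [e] at h2
  exact h2

end Facts

theorem emb_rel2 {M N : Type*} [(LPlus L1).Structure M] [(LPlus L1).Structure N]
    (f : M ↪[LPlus L1] N) (R : L1.Relations 2) (x y : M) :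
    rel2 R (f x) (f y) ↔ rel2 R x y := by
  have := f.map_rel (liftR R) ![x, y]
  have e : f ∘ ![x, y] = ![f x, f y] := by
    funext i; fin_cases i <;> rfl
  rw [e] at this
  exact this

theorem emb_sigma {M N : Type*} [(LPlus L1).Structure M] [(LPlus L1).Structure N]
    (f : M ↪[LPlus L1] N) (x : M) : f (sigmaMap L1 M x) = sigmaMap L1 N (f x) := by
  have := f.map_fun (sigmaSymb L1) ![x]
  have e : f ∘ ![x] = ![f x] := by
    funext i; fin_cases i; rfl
  rw [e] at this
  exact this

/-- If `σ` flips bit `m`, no extension has a fixed `E`-class. -/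
theorem no_fixed (D : Dat.{u}) (hb : D.b = true) {N : Type*} [(LPlus L1).Structure N]
    (hN : N ⊨ Taut (L1.completeTheory M1Point)) (f : W D ↪[LPlus L1] N) (k : D.I) (y : N) :
    ¬ rel2 symE y (sigmaMap L1 N y) := by
  intro hy
  have near : ∀ n, ∃ a : W D, rel2 (symEn n) (f a) y := by
    intro n
    induction n with
    | zero => exact ⟨(fun _ => false, k, 0, false), E0_total hN _ _⟩
    | succ n ih =>
      obtain ⟨a, ha⟩ := ih
      by_cases h : rel2 (symEn (n+1)) (f a) y
      · exact ⟨a, h⟩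
      let a' : W D := (fun i => xor (a.1 i) (decide (i = n)), a.2.1, a.2.2.1, a.2.2.2)
      have hc : ∀ i, a'.code i = xor (a.code i) (decide (i = n)) := by
        intro i
        simp only [W.code, a']
        cases a.1 i <;> cases D.p a.2.1 <;> cases decide (i = n) <;>
          cases decide (i = D.m) <;> rfl
      have h1 : rel2 (symEn n) a a' := by
        change ∀ i < n, a.code i = a'.code i
        intro i hi
        rw [hc]; simp [hi.ne]
      have h2 : ¬ rel2 (symEn (n+1)) a a' := by
        change ¬ ∀ i < n+1, a.code i = a'.code i
        intro h
        have := h n (Nat.lt_succ_self n)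
        rw [hc] at this; simp at this
      refine ⟨a', En_symm hN _ ?_⟩
      have h1' := (emb_rel2 f _ _ _).2 h1
      have h2' := fun h => h2 ((emb_rel2 f _ _ _).1 h)
      exact En_split hN n (En_symm hN _ ha) (En_trans hN _ (En_symm hN _ ha) h1') h2'
        fun h' => h (En_symm hN _ h')
  obtain ⟨a, ha⟩ := near (D.m + 1)
  have h1 := E_refine hN (D.m+1) hy
  have h2 := sig_pres hN _ ha
  have h3 := En_trans hN _ ha (En_trans hN _ h1 (En_symm hN _ h2))
  rw [← emb_sigma, emb_rel2] at h3
  have h4 : ∀ i < D.m + 1, a.code i = a.sig.code i := h3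
  have h5 := h4 D.m (Nat.lt_succ_self _)
  rw [W.code_sig, hb] at h5
  simp at h5

section Diagram

variable {L' : Language.{u, v}} {M : Type w} [L'.Structure M]

/-- `N` as a structure for the language with names for `M`, interpreted through `g`. -/
@[reducible] def constStr {N : Type*} (g : M → N) : (constantsOn M).Structure N :=
  constantsOn.structure g

theorem term_eq {N : Type*} [L'.Structure N] (g : M → N)
    (hf : ∀ (n : ℕ) (F : L'.Functions n) (x : Fin n → M), g (funMap F x) = funMap F (g ∘ x))
    {α : Type*} (t : (L'[[M]]).Term α) (v : α → M) :
    letI := constStr g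
    t.realize (g ∘ v) = g (t.realize v) := by
  letI := constStr g
  induction t with
  | var a => rfl
  | @func n F ts ih =>
    have e : (fun i => (ts i).realize (g ∘ v)) = g ∘ fun i => (ts i).realize v := funext ih
    rw [Term.realize_func, e, Term.realize_func]
    cases F with
    | inl F => exact (hf n F _).symm
    | inr c =>
      cases n with
      | zero => rfl
      | succ n => exact isEmptyElim c

theorem diag_eventually {N : ℕ → Type*} [∀ m, L'.Structure (N m)] (g : ∀ m, M → N m)
    (hinj : ∀ m, Function.Injective (g m))
    (hf : ∀ (m n : ℕ) (F : L'.Functions n) (x : Fin n → M),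
      g m (funMap F x) = funMap F (g m ∘ x))
    (hr : ∀ (n : ℕ) (R : L'.Relations n), ∀ᶠ m in Filter.atTop, ∀ x : Fin n → M,
      RelMap R (g m ∘ x) ↔ RelMap R x)
    (ψ : (L'[[M]]).Sentence) (hψ : ψ ∈ atomicDiagram L' M) :
    ∀ᶠ m in Filter.atTop, @Sentence.Realize (L'[[M]]) (N m)
      (@withConstantsStructure L' (N m) _ M (constStr (g m))) ψ := by
  have key : ∀ χ : (L'[[M]]).Sentence, χ.IsAtomic → ∀ᶠ m in Filter.atTop,
      (@Sentence.Realize (L'[[M]]) (N m)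
      (@withConstantsStructure L' (N m) _ M (constStr (g m))) χ ↔ M ⊨ χ) := by
    intro χ hχ
    cases hχ with
    | equal t₁ t₂ =>
      refine Filter.Eventually.of_forall fun m => ?_
      letI := constStr (g m)
      have h1 := fun t => term_eq (g m) (hf m) (t : (L'[[M]]).Term (Empty ⊕ Fin 0))
        (Sum.elim default default)
      have e : (g m ∘ Sum.elim default default : Empty ⊕ Fin 0 → N m) =
        Sum.elim default default := Subsingleton.elim _ _
      simp only [e] at h1
      simp only [Sentence.Realize, Formula.Realize, BoundedFormula.realize_bdEqual]
      rw [h1, h1, (hinj m).eq_iff]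
    | @rel l R ts =>
      have hr' : ∀ᶠ m in Filter.atTop, ∀ x : Fin l → M,
          @RelMap (L'[[M]]) (N m) (@withConstantsStructure L' (N m) _ M (constStr (g m))) l R
            (g m ∘ x) ↔ RelMap R x := by
        cases R with
        | inr R => exact isEmptyElim R
        | inl R => exact hr l R
      filter_upwards [hr'] with m hm
      letI := constStr (g m)
      have h1 := fun t => term_eq (g m) (hf m) (t : (L'[[M]]).Term (Empty ⊕ Fin 0))
        (Sum.elim default default)
      have e : (g m ∘ Sum.elim default default : Empty ⊕ Fin 0 → N m) =
        Sum.elim default default := Subsingleton.elim _ _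
      simp only [e] at h1
      simp only [Sentence.Realize, Formula.Realize, BoundedFormula.realize_rel]
      simp only [h1]
      exact hm _
  obtain ⟨h | ⟨χ, hχ, rfl⟩, hM⟩ := hψ
  · filter_upwards [key ψ h] with m hm
    exact hm.2 hM
  · filter_upwards [key χ hχ] with m hm
    letI := constStr (g m)
    rw [Sentence.realize_not] at hM ⊢
    exact fun h => hM (hm.1 h)

end Diagram

/-- There is a `σ`-fixed `E`-class. -/
def fixS : (LPlus L1).Sentence :=
  ∃' ((liftR symE).boundedFormula₂ (&0) (sigmaTerm (&0)))

theorem realize_fixS {N : Type*} [(LPlus L1).Structure N] :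
    N ⊨ fixS ↔ ∃ y : N, rel2 symE y (sigmaMap L1 N y) := by
  simp only [fixS, Sentence.Realize, Formula.Realize, BoundedFormula.realize_ex,
    BoundedFormula.realize_rel₂, realize_sigmaTerm]
  rfl

/-- The shift on the integers. -/
def shift : ULift.{u} ℤ ≃ ULift.{u} ℤ where
  toFun k := ⟨k.down + 1⟩
  invFun k := ⟨k.down - 1⟩
  left_inv k := by simp
  right_inv k := by simp

/-- The base model. -/
def D0 : Dat.{u} := ⟨ULift ℤ, shift, fun _ => false, 0, false, fun _ => rfl⟩

/-- The base model with additional fixed classes. -/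
def DK : Dat.{u} := ⟨Option (ULift ℤ), Equiv.optionCongr shift, fun _ => false, 0, false,
  fun _ => rfl⟩

/-- The approximation in which `σ` flips bit `m`. -/
def DM (m : ℕ) : Dat.{u} := ⟨ULift ℤ, shift, fun k => k.down.bodd, m, true, fun k => by
  simp [shift, Int.bodd_add]⟩

theorem nonempty_equiv_nat (I : Type u) [Countable I] [Infinite I] : Nonempty (I ≃ ℕ) := by
  obtain ⟨_⟩ := nonempty_denumerable I
  exact ⟨Denumerable.eqv I⟩

instance (D : Dat.{u}) [Nonempty D.I] : Nonempty (W D) :=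
  ⟨(fun _ => false, Classical.arbitrary _, 0, false)⟩

/-- The inclusion of the base model into its extension. -/
def embK : W D0.{u} ↪[LPlus L1] W DK.{u} where
  toFun x := (x.1, some x.2.1, x.2.2.1, x.2.2.2)
  inj' x y h := by
    have h1 := congrArg Prod.fst h
    have h2 := congrArg (fun z => z.2.1) h
    have h3 := congrArg (fun z => z.2.2) h
    exact Prod.ext h1 (Prod.ext (Option.some_injective _ h2) h3)
  map_fun' F x := by
    cases F with
    | inl F => exact F.elim
    | inr F =>
      cases F
      rfl
  map_rel' R x := by
    cases R with
    | inr R => exact R.elim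
    | inl R =>
      cases R with
      | En n => exact Iff.rfl
      | E => exact and_congr_right fun _ => (Option.some_injective _).eq_iff
      | Estar => exact and_congr_right fun _ => and_congr_left fun _ =>
          (Option.some_injective _).eq_iff
      | P m => exact Iff.rfl

/-- The identity from the base model to the approximation. -/
def toM (m : ℕ) : W D0.{u} → W (DM.{u} m) := fun x => x

theorem toM_rel (n : ℕ) (R : (LPlus L1).Relations n) :
    ∀ᶠ m in Filter.atTop, ∀ x : Fin n → W D0.{u}, RelMap R (toM m ∘ x) ↔ RelMap R x := by
  cases R with
  | inr R => exact R.elim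
  | inl R =>
    cases R with
    | En n =>
      filter_upwards [Filter.eventually_ge_atTop n] with m hm x
      have hc : ∀ (y : W D0.{u}) (i : ℕ), i < n → (toM m y).code i = y.code i := by
        intro y i hi
        have : i ≠ m := (hi.trans_le hm).ne
        simp [W.code, toM, DM, D0, this]
      change (∀ i < n, (toM m (x 0)).code i = (toM m (x 1)).code i) ↔
        (∀ i < n, (x 0).code i = (x 1).code i)
      refine forall₂_congr fun i hi => ?_
      rw [hc _ i hi, hc _ i hi]
    | E => exact Filter.Eventually.of_forall fun m x => Iff.rfl
    | Estar => exact Filter.Eventually.of_forall fun m x => Iff.rfl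
    | P m => exact Filter.Eventually.of_forall fun m x => Iff.rfl

theorem toM_fun (m n : ℕ) (F : (LPlus L1).Functions n) (x : Fin n → W D0.{u}) :
    toM m (funMap F x) = funMap F (toM m ∘ x) := by
  cases F with
  | inl F => exact F.elim
  | inr F =>
    cases F
    rfl

theorem Taut_ThM1_has_no_modelCompletion :
    ¬ ∃ Tstar : (LPlus L1).Theory,
      IsModelCompletion.{0, 0, u} (Taut (L1.completeTheory M1Point)) Tstar := by
  rintro ⟨T, hT, hemb, hcomp⟩
  let S : (LPlus L1).Theory := Taut (L1.completeTheory M1Point)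
  obtain ⟨j⟩ := nonempty_equiv_nat (ULift.{u} ℤ)
  obtain ⟨jK⟩ := nonempty_equiv_nat (Option (ULift.{u} ℤ))
  haveI : Nonempty D0.{u}.I := inferInstanceAs (Nonempty (ULift.{u} ℤ))
  haveI : Nonempty DK.{u}.I := inferInstanceAs (Nonempty (Option (ULift.{u} ℤ)))
  haveI : ∀ m, Nonempty (DM.{u} m).I := fun m => inferInstanceAs (Nonempty (ULift.{u} ℤ))
  haveI h0 : W D0.{u} ⊨ S := W.model D0 j
  haveI hK : W DK.{u} ⊨ S := W.model DK jK
  haveI hM : ∀ m, W (DM.{u} m) ⊨ S := fun m => W.model (DM m) j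
  let M0 : Theory.ModelType.{0, 0, u} S := Theory.ModelType.of S (W D0.{u})
  obtain ⟨NK, ⟨fK⟩⟩ := hemb (Theory.ModelType.of S (W DK.{u}))
  have hNK : NK ⊨ fixS := by
    rw [realize_fixS]
    let y : W DK.{u} := (fun _ => false, none, 0, false)
    have hy : rel2 symE y (sigmaMap L1 (W DK.{u}) y) := ⟨rfl, rfl⟩
    let fK' : W DK.{u} ↪[LPlus L1] NK := fK
    refine ⟨fK' y, ?_⟩
    rw [← emb_sigma, emb_rel2]
    exact hy
  have hproves : ((LPlus L1).lhomWithConstants M0).onTheory T ∪ atomicDiagram (LPlus L1) M0 ⊨ᵇ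
      ((LPlus L1).lhomWithConstants M0).onSentence fixS := by
    rcases (hcomp M0).2 (((LPlus L1).lhomWithConstants M0).onSentence fixS) with h | h
    · exact h
    exfalso
    let g : W D0.{u} ↪[LPlus L1] NK := Embedding.comp fK embK
    letI : (constantsOn M0).Structure NK := constStr g
    haveI : NK ⊨ ((LPlus L1).lhomWithConstants M0).onTheory T ∪
        atomicDiagram (LPlus L1) M0 := by
      refine Theory.Model.union ?_ ?_
      · rw [LHom.onTheory_model]; infer_instance
      · rw [Theory.model_iff]
        intro ψ hψ
        have := diag_eventually (L' := LPlus L1) (M := M0) (N := fun _ => NK) (fun _ => g)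
          (fun _ => g.injective) (fun _ _ F x => g.map_fun F x)
          (fun _ R => Filter.Eventually.of_forall fun _ x => g.map_rel R x) ψ hψ
        exact this.exists.choose_spec
    have h' := h.realize_sentence NK
    rw [Sentence.realize_not, LHom.realize_onSentence] at h'
    exact h' hNK
  rw [Theory.models_iff_finset_models] at hproves
  obtain ⟨T0, hT0, hpr⟩ := hproves
  choose N f using fun m => hemb (Theory.ModelType.of S (W (DM.{u} m)))
  let f' : ∀ m, W (DM.{u} m) ↪[LPlus L1] N m := fun m => (f m).some
  let g : ∀ m, M0 → N m := fun m x => f' m (toM m x)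
  have hev : ∀ ψ ∈ T0, ∀ᶠ m in Filter.atTop, @Sentence.Realize ((LPlus L1)[[M0]]) (N m)
      (@withConstantsStructure (LPlus L1) (N m) _ M0 (constStr (g m))) ψ := by
    intro ψ hψ
    rcases hT0 hψ with h | h
    · obtain ⟨χ, hχ, rfl⟩ := h
      refine Filter.Eventually.of_forall fun m => ?_
      letI := constStr (g m)
      exact (LHom.realize_onSentence (N m) ((LPlus L1).lhomWithConstants M0) χ).2
        (Theory.realize_sentence_of_mem T hχ)
    · refine diag_eventually (L' := LPlus L1) (M := M0) (N := fun m => N m) g ?_ ?_ ?_ ψ h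
      · exact fun m x y hxy => (f' m).injective hxy
      · intro m n F x
        exact (congrArg (f' m) (toM_fun m n F x)).trans ((f' m).map_fun F _)
      · intro n R
        filter_upwards [toM_rel.{u} n R] with m hm x
        exact ((f' m).map_rel R _).trans (hm x)
  rw [← Filter.eventually_all_finset] at hev
  obtain ⟨m, hm⟩ := hev.exists
  letI := constStr (g m)
  haveI : N m ⊨ (T0 : ((LPlus L1)[[M0]]).Theory) := (Theory.model_iff _).2 fun ψ hψ => hm ψ hψ
  have h1 := hpr.realize_sentence (N m)
  rw [LHom.realize_onSentence, realize_fixS] at h1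
  obtain ⟨y, hy⟩ := h1
  have hN : N m ⊨ S := (Theory.model_iff _).2 fun ψ hψ =>
    Theory.realize_sentence_of_mem T (hT hψ)
  exact no_fixed (DM m) rfl hN (f' m) ⟨0⟩ y hy

end ShelahE34

end FirstOrder
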